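/- For every compatible positive complex structure j on (E, ω), the Hermitian form on Λ^{n,0}_j E* defined by ⟨α, β⟩_j := i^{n(2−n)} · (α ∧ β̄ / ω^{∧n}) is positive definite: ⟨α, α⟩_j is a positive real number for every α ≠ 0. -/

import Mathlib

open Complex

noncomputable section

variable {E : Type*} [AddCommGroup E] [Module ℝ E]

/-- `j` is a complex structure on `E`: `j ∘ j = -id`. -/
def IsCplxStruct (j : E →ₗ[ℝ] E) : Prop := ∀ x : E, j (j x) = -x

/-- `j` is compatible with the symplectic form `ω`. -/
def OmCompat (ω : E [⋀^Fin 2]→ₗ[ℝ] ℝ) (j : E →ₗ[ℝ] E) : Prop :=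
  ∀ x y : E, ω ![j x, j y] = ω ![x, y]

/-- `j` is positive with respect to `ω`. -/
def OmPos (ω : E [⋀^Fin 2]→ₗ[ℝ] ℝ) (j : E →ₗ[ℝ] E) : Prop :=
  ∀ x : E, x ≠ 0 → 0 < ω ![x, j x]

/-- `ω` is nondegenerate. -/
def OmNondeg (ω : E [⋀^Fin 2]→ₗ[ℝ] ℝ) : Prop :=
  ∀ x : E, (∀ y : E, ω ![x, y] = 0) → x = 0

/-- The complex conjugate of a `ℂ`-valued alternating form. -/
def conjAlt {p : ℕ} (α : E [⋀^Fin p]→ₗ[ℝ] ℂ) : E [⋀^Fin p]→ₗ[ℝ] ℂ :=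
  Complex.conjAe.toLinearMap.compAlternatingMap α

/-- Wedge product of `ℂ`-valued alternating forms. -/
def wedgeC {p q : ℕ} (α : E [⋀^Fin p]→ₗ[ℝ] ℂ) (β : E [⋀^Fin q]→ₗ[ℝ] ℂ) :
    E [⋀^Fin (p + q)]→ₗ[ℝ] ℂ :=
  ((LinearMap.mul' ℝ ℂ).compAlternatingMap (α.domCoprod β)).domDomCongr finSumFinEquiv

/-- The complexification of a real-valued alternating form. -/
def cplxForm {p : ℕ} (ω : E [⋀^Fin p]→ₗ[ℝ] ℝ) : E [⋀^Fin p]→ₗ[ℝ] ℂ :=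
  (Algebra.linearMap ℝ ℂ).compAlternatingMap ω

/-- `ω^{∧ m}`. -/
def omPow (ω : E [⋀^Fin 2]→ₗ[ℝ] ℝ) : (m : ℕ) → E [⋀^Fin (2 * m)]→ₗ[ℝ] ℂ
  | 0 => (AlternatingMap.constOfIsEmpty ℝ E (Fin 0) 1).domDomCongr (finCongr (by ring))
  | (m + 1) => (wedgeC (cplxForm ω) (omPow ω m)).domDomCongr (finCongr (by ring))

/-- `ω^{∧ n}`, reindexed by `Fin (n + n)`. -/
def topPow (ω : E [⋀^Fin 2]→ₗ[ℝ] ℝ) (n : ℕ) : E [⋀^Fin (n + n)]→ₗ[ℝ] ℂ :=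
  (omPow ω n).domDomCongr (finCongr (by ring))

/-- `Λ^{n,0}_j E*`: the space of `ℂ`-valued alternating `p`-forms `α` with
`α (j v₁, v₂, …, v_p) = i • α (v₁, …, v_p)`. -/
def Lam (j : E →ₗ[ℝ] E) (p : ℕ) : Submodule ℂ (E [⋀^Fin p]→ₗ[ℝ] ℂ) where
  carrier := {α | ∀ (v : Fin p → E) (i : Fin p), (i : ℕ) = 0 →
    α (Function.update v i (j (v i))) = Complex.I * α v}
  add_mem' := by
    intro a b ha hb v i hi
    simp only [AlternatingMap.add_apply, ha v i hi, hb v i hi]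
    ring
  zero_mem' := by
    intro v i hi
    simp
  smul_mem' := by
    intro c a ha v i hi
    simp only [AlternatingMap.smul_apply, ha v i hi, smul_eq_mul]
    ring

/-- The scalar `α ∧ β̄ / ω^{∧ n}`. -/
def pairing (ω : E [⋀^Fin 2]→ₗ[ℝ] ℝ) (n : ℕ) (α β : E [⋀^Fin n]→ₗ[ℝ] ℂ) : ℂ :=
  letI := Classical.propDecidable (∃ c : ℂ, wedgeC α (conjAlt β) = c • topPow ω n)
  if h : ∃ c : ℂ, wedgeC α (conjAlt β) = c • topPow ω n then h.choose else 0

/-- The Hermitian form `⟨α, β⟩_j := i^{n(2−n)} · (α ∧ β̄ / ω^{∧n})`. -/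
def hermForm (ω : E [⋀^Fin 2]→ₗ[ℝ] ℝ) (n : ℕ) (α β : E [⋀^Fin n]→ₗ[ℝ] ℂ) : ℂ :=
  Complex.I ^ ((n : ℤ) * (2 - (n : ℤ))) * pairing ω n α β


/-- The `p`-form `(v₁, …, v_p) ↦ det (r_k (v_l))` attached to `p` linear functionals `r_k`. -/
def detForm {p : ℕ} (r : Fin p → (E →ₗ[ℝ] ℂ)) : E [⋀^Fin p]→ₗ[ℝ] ℂ :=
  MultilinearMap.alternatization
    ((MultilinearMap.mkPiAlgebra ℝ (Fin p) ℂ).compLinearMap r)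

theorem detForm_apply {p : ℕ} (r : Fin p → (E →ₗ[ℝ] ℂ)) (v : Fin p → E) :
    detForm r v = (Matrix.of fun k l => r k (v l)).det := by
  rw [← Matrix.det_transpose]
  simp [detForm, MultilinearMap.alternatization_apply, Matrix.det_apply]

theorem wedgeC_detForm {p q : ℕ} (r : Fin p → (E →ₗ[ℝ] ℂ)) (s : Fin q → (E →ₗ[ℝ] ℂ)) :
    wedgeC (detForm r) (detForm s) = detForm (Fin.append r s) := by
  unfold wedgeC detForm
  rw [← MultilinearMap.domCoprod_alternization, ← LinearMap.compMultilinearMap_alternatization]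
  ext v
  simp only [AlternatingMap.domDomCongr_apply, MultilinearMap.alternatization_apply]
  refine Fintype.sum_equiv finSumFinEquiv.permCongr _ _ fun σ => ?_
  simp [Fin.prod_univ_add]

theorem alternatingMap_sum_apply {ι κ N : Type*} [AddCommGroup N] [Module ℝ N] (s : Finset κ)
    (f : κ → E [⋀^ι]→ₗ[ℝ] N) (v : ι → E) : (∑ k ∈ s, f k) v = ∑ k ∈ s, f k v := by
  classical
  induction s using Finset.induction_on with
  | empty => simp
  | insert k s hk ih => simp [Finset.sum_insert hk, ih]

theorem wedgeC_sum {p q : ℕ} {ι κ : Type*} (s : Finset ι) (t : Finset κ)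
    (α : ι → E [⋀^Fin p]→ₗ[ℝ] ℂ) (β : κ → E [⋀^Fin q]→ₗ[ℝ] ℂ) :
    wedgeC (∑ i ∈ s, α i) (∑ k ∈ t, β k) = ∑ i ∈ s, ∑ k ∈ t, wedgeC (α i) (β k) := by
  ext v
  simp only [wedgeC, AlternatingMap.domDomCongr_apply, LinearMap.compAlternatingMap_apply,
    ← AlternatingMap.domCoprod'_apply, TensorProduct.sum_tmul, TensorProduct.tmul_sum, map_sum,
    alternatingMap_sum_apply]
  exact Finset.sum_comm

theorem wedgeC_smul {p q : ℕ} (a b : ℂ) (α : E [⋀^Fin p]→ₗ[ℝ] ℂ) (β : E [⋀^Fin q]→ₗ[ℝ] ℂ) :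
    wedgeC (a • α) (b • β) = (a * b) • wedgeC α β := by
  ext v
  simp only [wedgeC, AlternatingMap.domDomCongr_apply, LinearMap.compAlternatingMap_apply,
    AlternatingMap.domCoprod_apply, AlternatingMap.smul_apply, _root_.sum_apply, map_sum,
    Finset.smul_sum]
  refine Finset.sum_congr rfl fun σ _ => ?_
  induction σ using Quotient.inductionOn' with
  | h σ =>
    simp [AlternatingMap.domCoprod.summand_mk'']
    simp only [Units.smul_def, zsmul_eq_mul]
    ring

theorem detForm_comp_perm {p : ℕ} (r : Fin p → (E →ₗ[ℝ] ℂ)) (σ : Equiv.Perm (Fin p)) :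
    detForm (r ∘ σ) = (Equiv.Perm.sign σ : ℂ) • detForm r := by
  ext v
  simp only [AlternatingMap.smul_apply, detForm_apply, smul_eq_mul, ← Matrix.det_permute]
  rfl

theorem detForm_eq_zero {p : ℕ} (r : Fin p → (E →ₗ[ℝ] ℂ)) {i k : Fin p} (hik : i ≠ k)
    (h : r i = r k) : detForm r = 0 := by
  ext v
  rw [detForm_apply]
  exact Matrix.det_zero_of_row_eq hik (by ext c; simp [h])

theorem detForm_append_apply {n : ℕ} (x y : Fin n → (E →ₗ[ℝ] ℂ)) (v : Fin (n + n) → E) :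
    detForm (Fin.append x y) v =
      (Matrix.fromBlocks (Matrix.of fun k l => x k (v (Fin.castAdd n l)))
        (Matrix.of fun k l => x k (v (Fin.natAdd n l)))
        (Matrix.of fun k l => y k (v (Fin.castAdd n l)))
        (Matrix.of fun k l => y k (v (Fin.natAdd n l)))).det := by
  rw [detForm_apply, ← Matrix.det_submatrix_equiv_self finSumFinEquiv]
  congr 1
  ext (i | i) (k | k) <;> simp [-Fin.natAdd_eq_addNat]

/-- Replacing real coordinates `x`, `y` by `x + iy`, `x - iy` multiplies the volume form by
`(-2i)^n`. -/
theorem detForm_append_add_sub {n : ℕ} (x y : Fin n → (E →ₗ[ℝ] ℂ)) :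
    detForm (Fin.append (fun k => x k + I • y k) (fun k => x k - I • y k)) =
      (-2 * I) ^ n • detForm (Fin.append x y) := by
  ext v
  have key : (Matrix.fromBlocks (1 : Matrix (Fin n) (Fin n) ℂ)
      (I • (1 : Matrix (Fin n) (Fin n) ℂ)) 1 (-I • (1 : Matrix (Fin n) (Fin n) ℂ))).det =
      (-2 * I) ^ n := by
    rw [Matrix.det_fromBlocks_one₁₁, Matrix.one_mul, ← sub_smul, Matrix.det_smul, Matrix.det_one,
      Fintype.card_fin, mul_one]
    ring
  rw [AlternatingMap.smul_apply, detForm_append_apply, detForm_append_apply, smul_eq_mul, ← key,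
    ← Matrix.det_mul, Matrix.fromBlocks_multiply]
  congr 1
  ext (i | i) (k | k) <;> simp [sub_eq_add_neg]

/-- The functionals `x (l 0), y (l 0), x (l 1), y (l 1), …`. -/
def pairRows {n m : ℕ} (x y : Fin n → (E →ₗ[ℝ] ℂ)) (l : Fin m → Fin n) :
    Fin (2 * m) → (E →ₗ[ℝ] ℂ) :=
  fun p => if (p : ℕ) % 2 = 0 then x (l ⟨p / 2, by omega⟩) else y (l ⟨p / 2, by omega⟩)

theorem pairRows_cons {n m : ℕ} (x y : Fin n → (E →ₗ[ℝ] ℂ)) (k : Fin n) (l : Fin m → Fin n)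
    (h : 2 + 2 * m = 2 * (m + 1)) :
    pairRows x y (Fin.cons k l : Fin (m + 1) → Fin n) ∘ Fin.cast h =
      Fin.append ![x k, y k] (pairRows x y l) := by
  ext1 p
  refine Fin.addCases (fun i => ?_) (fun i => ?_) p
  · fin_cases i <;> simp [pairRows]
  · simp [pairRows]
    rfl

theorem detForm_domDomCongr_cast {p q : ℕ} (h : p = q) (r : Fin q → (E →ₗ[ℝ] ℂ)) :
    (detForm (r ∘ Fin.cast h)).domDomCongr (finCongr h) = detForm r := by
  subst h
  rfl

theorem omPow_eq_sum {n : ℕ} (ω : E [⋀^Fin 2]→ₗ[ℝ] ℝ) (x y : Fin n → (E →ₗ[ℝ] ℂ))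
    (h : cplxForm ω = ∑ k, detForm ![x k, y k]) (m : ℕ) :
    omPow ω m = ∑ l : Fin m → Fin n, detForm (pairRows x y l) := by
  induction m with
  | zero =>
    ext v
    simp [omPow, detForm_apply]
  | succ m ih =>
    rw [omPow, ih, h, wedgeC_sum, ← (Fin.consEquiv fun _ => Fin n).sum_comp, Fintype.sum_prod_type]
    ext v
    simp only [AlternatingMap.domDomCongr_apply, alternatingMap_sum_apply, wedgeC_detForm]
    refine Finset.sum_congr rfl fun k _ => Finset.sum_congr rfl fun l _ => ?_
    rw [← pairRows_cons x y k l (by ring), ← AlternatingMap.domDomCongr_apply,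
      detForm_domDomCongr_cast]
    rfl

/-- The permutation `0, 1, …, 2n - 1 ↦ 0, 2, …, 2n - 2, 1, 3, …, 2n - 1`. -/
def interleave (n : ℕ) : Equiv.Perm (Fin (n + n)) :=
  finSumFinEquiv.symm.trans
    { toFun := Sum.elim (fun k => ⟨2 * k, by omega⟩) (fun k => ⟨2 * k + 1, by omega⟩)
      invFun := fun p => if (p : ℕ) % 2 = 0 then .inl ⟨p / 2, by omega⟩ else .inr ⟨p / 2, by omega⟩
      left_inv := by
        rintro (k | k)
        · simp
        · simp only [Sum.elim_inr, Nat.mul_add_mod_self_left, Nat.one_mod, one_ne_zero, if_false,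
            Sum.inr.injEq, Fin.ext_iff]
          omega
      right_inv := by
        intro p
        dsimp only
        split_ifs with hp <;> ext <;> simp <;> omega }

theorem interleave_castAdd {n : ℕ} (k : Fin n) :
    (interleave n (Fin.castAdd n k) : ℕ) = 2 * k := by
  simp [interleave, -Fin.natAdd_eq_addNat]

theorem interleave_natAdd {n : ℕ} (k : Fin n) :
    (interleave n (Fin.natAdd n k) : ℕ) = 2 * k + 1 := by
  simp [interleave, -Fin.natAdd_eq_addNat]

theorem sign_interleave (n : ℕ) :
    Equiv.Perm.sign (interleave n) = (-1) ^ (n * (n - 1) / 2) := by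
  have hrow (k : Fin n) :
      (∏ l : Fin n, if k ≤ l then (1 : ℤˣ) else -1) = (-1) ^ (k : ℕ) := by
    simp [Finset.prod_ite, not_le, Finset.filter_gt_eq_Iio]
  rw [Equiv.Perm.sign_eq_prod_prod_Ioi]
  simp only [← Finset.filter_lt_eq_Ioi, Finset.prod_filter, Fin.prod_univ_add, Fin.lt_def,
    interleave_castAdd, interleave_natAdd, Fin.val_castAdd, Fin.val_natAdd]
  have h1 (k l : Fin n) : (if (k : ℕ) < l then if 2 * (k : ℕ) < 2 * l then (1 : ℤˣ) else -1 else 1)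
      = 1 := by split_ifs <;> first | rfl | omega
  have h2 (k l : Fin n) : (if (n + k : ℕ) < n + l then
      if 2 * (k : ℕ) + 1 < 2 * l + 1 then (1 : ℤˣ) else -1 else 1) = 1 := by
    split_ifs <;> first | rfl | omega
  have h3 (k l : Fin n) : (if (n + k : ℕ) < l then
      if 2 * (k : ℕ) + 1 < 2 * l then (1 : ℤˣ) else -1 else 1) = 1 := by
    split_ifs <;> first | rfl | omega
  have h4 (k l : Fin n) : (if (k : ℕ) < n + l then
      if 2 * (k : ℕ) < 2 * l + 1 then (1 : ℤˣ) else -1 else 1) = if k ≤ l then 1 else -1 := by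
    simp only [Fin.le_def]
    split_ifs <;> first | rfl | omega
  simp only [h1, h2, h3, h4, hrow, Finset.prod_const_one, one_mul, mul_one]
  rw [Finset.prod_pow_eq_pow_sum, Fin.sum_univ_eq_sum_range (fun i => i), Finset.sum_range_id]

theorem pairRows_comp_interleave {n : ℕ} (x y : Fin n → (E →ₗ[ℝ] ℂ)) (l : Fin n → Fin n)
    (h : n + n = 2 * n) :
    (pairRows x y l ∘ Fin.cast h) ∘ interleave n = Fin.append (x ∘ l) (y ∘ l) := by
  ext1 p
  refine Fin.addCases (fun i => ?_) (fun i => ?_) p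
  · simp [pairRows, interleave_castAdd]
  · have h2 : (⟨(2 * i + 1 : ℕ) / 2, by omega⟩ : Fin n) = i := by
      ext; simp; omega
    simp [pairRows, interleave_natAdd, h2, -Fin.natAdd_eq_addNat]

theorem detForm_append_comp_perm {n : ℕ} (x y : Fin n → (E →ₗ[ℝ] ℂ)) (σ : Equiv.Perm (Fin n)) :
    detForm (Fin.append (x ∘ σ) (y ∘ σ)) = detForm (Fin.append x y) := by
  have h : Fin.append (x ∘ σ) (y ∘ σ) =
      Fin.append x y ∘ finSumFinEquiv.permCongr (Equiv.Perm.sumCongr σ σ) := by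
    ext1 p
    refine Fin.addCases (fun i => ?_) (fun i => ?_) p <;> 
      simp [Equiv.permCongr_apply, -Fin.natAdd_eq_addNat]
  rw [h, detForm_comp_perm, Equiv.Perm.sign_permCongr, Equiv.Perm.sign_sumCongr,
    Int.units_mul_self]
  simp

theorem topPow_eq {n : ℕ} (ω : E [⋀^Fin 2]→ₗ[ℝ] ℝ) (x y : Fin n → (E →ₗ[ℝ] ℂ))
    (h : cplxForm ω = ∑ k, detForm ![x k, y k]) :
    topPow ω n = ((-1) ^ (n * (n - 1) / 2) * (n.factorial : ℂ)) • detForm (Fin.append x y) := by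
  have hn : n + n = 2 * n := by ring
  have hterm (l : Fin n → Fin n) : (detForm (pairRows x y l)).domDomCongr (finCongr hn.symm) =
      (-1 : ℂ) ^ (n * (n - 1) / 2) • detForm (Fin.append (x ∘ l) (y ∘ l)) := by
    have hcast : (pairRows x y l ∘ Fin.cast hn) ∘ Fin.cast hn.symm = pairRows x y l := rfl
    rw [← hcast, detForm_domDomCongr_cast, ← pairRows_comp_interleave x y l hn, detForm_comp_perm,
      sign_interleave, smul_smul]
    simp [← mul_pow]
  have hsum : topPow ω n = ∑ l : Fin n → Fin n,
      (-1 : ℂ) ^ (n * (n - 1) / 2) • detForm (Fin.append (x ∘ l) (y ∘ l)) := by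
    simp only [← hterm, topPow, omPow_eq_sum ω x y h]
    ext v
    simp only [AlternatingMap.domDomCongr_apply, alternatingMap_sum_apply]
  have hinj : ∑ l : Fin n → Fin n, detForm (Fin.append (x ∘ l) (y ∘ l)) =
      ∑ σ : Equiv.Perm (Fin n), detForm (Fin.append (x ∘ σ) (y ∘ σ)) := by
    symm
    refine Finset.sum_of_injOn (fun σ : Equiv.Perm (Fin n) => (σ : Fin n → Fin n))
      (DFunLike.coe_injective.injOn) (by simp) ?_ (by simp)
    intro l _ hl
    have hl' : ¬ Function.Injective l := fun hi =>
      hl ⟨Equiv.ofBijective l (Finite.injective_iff_bijective.mp hi), by simp, rfl⟩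
    obtain ⟨i, k, hik, hne⟩ := Function.not_injective_iff.mp hl'
    exact detForm_eq_zero _ (i := Fin.castAdd n i) (k := Fin.castAdd n k)
      (by simpa using hne) (by simp [hik])
  rw [hsum, ← Finset.smul_sum, hinj, Finset.sum_congr rfl fun σ _ => detForm_append_comp_perm x y σ,
    Finset.sum_const, Finset.card_univ, Fintype.card_perm, Fintype.card_fin, mul_smul,
    Nat.cast_smul_eq_nsmul]

theorem conjAlt_smul_detForm {p : ℕ} (a : ℂ) (r : Fin p → (E →ₗ[ℝ] ℂ)) :
    conjAlt (a • detForm r) =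
      (starRingEnd ℂ a) • detForm (fun k => conjAe.toLinearMap.comp (r k)) := by
  ext v
  simp only [conjAlt, LinearMap.compAlternatingMap_apply, AlternatingMap.smul_apply, detForm_apply,
    smul_eq_mul, AlgEquiv.toLinearMap_apply, conjAe_coe, map_mul, RingHom.map_det]
  rfl

theorem pairing_eq_of_eq_smul {ω : E [⋀^Fin 2]→ₗ[ℝ] ℝ} {n : ℕ} {α β : E [⋀^Fin n]→ₗ[ℝ] ℂ} {c : ℂ}
    (hω : topPow ω n ≠ 0) (h : wedgeC α (conjAlt β) = c • topPow ω n) : pairing ω n α β = c := by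
  have hex : ∃ c : ℂ, wedgeC α (conjAlt β) = c • topPow ω n := ⟨c, h⟩
  rw [pairing, dif_pos hex]
  exact smul_left_injective ℂ hω (hex.choose_spec.symm.trans h)

/-- The normalising factor `i^{n(2-n)}` makes the pairing of `dz₁ ∧ ⋯ ∧ dzₙ` with itself
positive. -/
theorem I_zpow_mul_eq {n : ℕ} (hn : 0 < n) :
    I ^ ((n : ℤ) * (2 - (n : ℤ))) * ((-2 * I) ^ n * (-1) ^ (n * (n - 1) / 2)) = 2 ^ n := by
  have heven : 2 * (n * (n - 1) / 2) = n * (n - 1) :=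
    Nat.mul_div_cancel' (Nat.even_mul_pred_self n).two_dvd
  have hsign : ((-1 : ℂ)) ^ (n * (n - 1) / 2) = I ^ ((n : ℤ) * ((n : ℤ) - 1)) := by
    rw [← I_sq, ← pow_mul, heven, ← zpow_natCast]
    push_cast [Nat.cast_sub hn]
    rfl
  calc _ = (-2 * I) ^ n * (I ^ ((n : ℤ) * (2 - (n : ℤ))) * I ^ ((n : ℤ) * ((n : ℤ) - 1))) := by
        rw [hsign]; ring
    _ = (-2 * I) ^ n * I ^ n := by
        rw [← zpow_add₀ I_ne_zero, ← zpow_natCast I]; congr 2; ring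
    _ = 2 ^ n := by
        rw [← mul_pow, mul_assoc, I_mul_I]; norm_num

section ComplexModule

variable [Module ℂ E]

theorem apply_update_I_smul {n : ℕ} {α : E [⋀^Fin n]→ₗ[ℝ] ℂ}
    (hα : ∀ (v : Fin n → E) (i : Fin n), (i : ℕ) = 0 →
      α (Function.update v i (I • v i)) = I * α v) (v : Fin n → E) (i : Fin n) :
    α (Function.update v i (I • v i)) = I * α v := by
  let z : Fin n := ⟨0, i.pos⟩
  by_cases hi : i = z
  · exact hα v i (by simp [hi, z])
  · have h := hα (v ∘ Equiv.swap i z) z rfl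
    have hup : Function.update (v ∘ Equiv.swap i z) z (I • (v ∘ Equiv.swap i z) z) =
        Function.update v i (I • v i) ∘ Equiv.swap i z := by
      ext k
      rcases eq_or_ne k z with rfl | hk
      · simp
      · have : Equiv.swap i z k ≠ i := fun h' => hk (by simpa using (Equiv.swap_apply_eq_iff.mp h'))
        simp [hk, this]
    rw [hup, α.map_swap _ hi, α.map_swap _ hi] at h
    linear_combination -h

variable [IsScalarTower ℝ ℂ E]

theorem re_smul_add_im_smul_I_smul (c : ℂ) (x : E) : c.re • x + c.im • I • x = c • x := by
  conv_rhs => rw [← re_add_im c, add_smul, mul_smul]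
  rw [← algebraMap_smul ℂ c.re x, ← algebraMap_smul ℂ c.im (I • x)]
  rfl

theorem apply_update_smul {n : ℕ} {α : E [⋀^Fin n]→ₗ[ℝ] ℂ}
    (hα : ∀ (v : Fin n → E) (i : Fin n), (i : ℕ) = 0 →
      α (Function.update v i (I • v i)) = I * α v) (v : Fin n → E) (i : Fin n) (c : ℂ) (x : E) :
    α (Function.update v i (c • x)) = c • α (Function.update v i x) := by
  have h := apply_update_I_smul hα (Function.update v i x) i
  simp only [Function.update_idem, Function.update_self] at h
  rw [← re_smul_add_im_smul_I_smul, α.map_update_add, α.map_update_smul, α.map_update_smul, h]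
  conv_rhs => rw [← re_add_im c]
  simp only [real_smul, smul_eq_mul]
  ring

/-- An `(n,0)`-form, as a complex multilinear alternating form. -/
def toComplexAlternating {n : ℕ} (α : E [⋀^Fin n]→ₗ[ℝ] ℂ)
    (hα : ∀ (v : Fin n → E) (i : Fin n), (i : ℕ) = 0 →
      α (Function.update v i (I • v i)) = I * α v) : E [⋀^Fin n]→ₗ[ℂ] ℂ where
  toFun := α
  map_update_add' v i x y := by
    convert α.map_update_add v i x y
  map_update_smul' v i c x := by
    convert apply_update_smul hα v i c x
  map_eq_zero_of_eq' := α.map_eq_zero_of_eq'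

theorem eq_smul_detForm_coord {n : ℕ} (b : Module.Basis (Fin n) ℂ E) {α : E [⋀^Fin n]→ₗ[ℝ] ℂ}
    (hα : ∀ (v : Fin n → E) (i : Fin n), (i : ℕ) = 0 →
      α (Function.update v i (I • v i)) = I * α v) :
    α = α b • detForm (fun k => (b.coord k).restrictScalars ℝ) := by
  ext v
  have h := DFunLike.congr_fun ((toComplexAlternating α hα).eq_smul_basis_det b) v
  rw [AlternatingMap.smul_apply, detForm_apply]
  exact h

theorem exists_unitary_basis [FiniteDimensional ℝ E] {n : ℕ} (hdim : Module.finrank ℝ E = 2 * n)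
    (ω : E [⋀^Fin 2]→ₗ[ℝ] ℝ) (hc : ∀ x y : E, ω ![I • x, I • y] = ω ![x, y])
    (hp : ∀ x : E, x ≠ 0 → 0 < ω ![x, I • x]) :
    ∃ b : Module.Basis (Fin n) ℂ E, ∀ x y : E, ω ![x, y] =
      ∑ k, ((b.repr x k).re * (b.repr y k).im - (b.repr x k).im * (b.repr y k).re) := by
  have hadd (x y z : E) : ω ![x + y, z] = ω ![x, z] + ω ![y, z] := ω.map_vecCons_add _ _ _
  have hsmul (c : ℝ) (x z : E) : ω ![c • x, z] = c * ω ![x, z] := ω.map_vecCons_smul _ _ _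
  have hneg (x y : E) : ω ![-x, y] = -ω ![x, y] := by
    simpa using hsmul (-1) x y
  have hswap (x y : E) : ω ![y, x] = -ω ![x, y] := by
    rw [← ω.map_swap ![x, y] (i := 0) (j := 1) (by simp)]
    congr 1
    ext k
    fin_cases k <;> simp
  have hI (x y : E) : ω ![I • x, y] = -ω ![x, I • y] := by
    rw [← hc (I • x) y, smul_smul, I_mul_I, neg_one_smul, hneg]
  have hneg' (x y : E) : ω ![x, -y] = -ω ![x, y] := by
    rw [hswap (-y), hneg, hswap x y, neg_neg]
  let core : InnerProductSpace.Core ℂ E :=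
    { inner := fun x y => ⟨ω ![x, I • y], ω ![x, y]⟩
      conj_inner_symm := fun x y => by
        apply Complex.ext
        · simp [hswap (I • x) y, hI]
        · simp [hswap x y]
      re_inner_nonneg := fun x => by
        rcases eq_or_ne x 0 with rfl | hx
        · simpa using (hsmul 0 0 0).ge
        · exact (hp x hx).le
      add_left := fun x y z => by
        apply Complex.ext <;> simp [hadd]
      smul_left := fun x y r => by
        rw [← re_smul_add_im_smul_I_smul r x]
        apply Complex.ext <;> simp [hadd, hsmul, hI, hneg', smul_smul]
      definite := fun x hx => by
        by_contra hne
        exact (hp x hne).ne' (congrArg Complex.re hx) }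
  let _ : NormedAddCommGroup E := core.toNormedAddCommGroup
  let _ : InnerProductSpace ℂ E := InnerProductSpace.ofCore core.toCore
  have : FiniteDimensional ℂ E := FiniteDimensional.right ℝ ℂ E
  have hfin : Module.finrank ℂ E = n := by
    have := Module.finrank_mul_finrank ℝ ℂ E
    rw [finrank_real_complex, hdim] at this
    omega
  let b := (stdOrthonormalBasis ℂ E).reindex (finCongr hfin)
  refine ⟨b.toBasis, fun x y => ?_⟩
  have him : ω ![x, y] = (inner ℂ x y).im := rfl
  rw [him, ← b.sum_inner_mul_inner x y, im_sum]
  refine Finset.sum_congr rfl fun k _ => ?_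
  rw [← inner_conj_symm x (b k), b.coe_toBasis_repr_apply, b.coe_toBasis_repr_apply,
    b.repr_apply_apply, b.repr_apply_apply]
  simp only [mul_im, conj_re, conj_im]
  ring

theorem hermForm_self_pos [FiniteDimensional ℝ E] {n : ℕ} (hn : 0 < n)
    (hdim : Module.finrank ℝ E = 2 * n) (ω : E [⋀^Fin 2]→ₗ[ℝ] ℝ)
    (hc : ∀ x y : E, ω ![I • x, I • y] = ω ![x, y])
    (hp : ∀ x : E, x ≠ 0 → 0 < ω ![x, I • x]) {α : E [⋀^Fin n]→ₗ[ℝ] ℂ}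
    (hα : ∀ (v : Fin n → E) (i : Fin n), (i : ℕ) = 0 →
      α (Function.update v i (I • v i)) = I * α v) (hα0 : α ≠ 0) :
    ∃ r : ℝ, 0 < r ∧ hermForm ω n α α = (r : ℂ) := by
  obtain ⟨b, hb⟩ := exists_unitary_basis hdim ω hc hp
  let z : Fin n → (E →ₗ[ℝ] ℂ) := fun k => (b.coord k).restrictScalars ℝ
  let x : Fin n → (E →ₗ[ℝ] ℂ) := fun k => (ofRealAm.toLinearMap.comp reLm).comp (z k)
  let y : Fin n → (E →ₗ[ℝ] ℂ) := fun k => (ofRealAm.toLinearMap.comp imLm).comp (z k)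
  have hz : z = fun k => x k + I • y k := by
    ext k v
    simp [x, y, mul_comm I, re_add_im]
  have hzbar : (fun k => conjAe.toLinearMap.comp (z k)) = fun k => x k - I • y k := by
    ext k v
    apply Complex.ext <;> simp [x, y]
  have hω : cplxForm ω = ∑ k, detForm ![x k, y k] := by
    ext v
    have hv : v = ![v 0, v 1] := by ext k; fin_cases k <;> rfl
    simp only [cplxForm, LinearMap.compAlternatingMap_apply, alternatingMap_sum_apply,
      detForm_apply, Matrix.det_fin_two]
    rw [hv, hb]
    simp [x, y, z, mul_comm]
  have htop := topPow_eq ω x y hω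
  have hone : detForm (Fin.append x y) (Fin.append b (fun k => I • b k)) = 1 := by
    rw [detForm_append_apply, ← Matrix.det_one (n := Fin n ⊕ Fin n), ← Matrix.fromBlocks_one]
    congr 1
    ext (i | i) (k | k) <;>
      simp [x, y, z, -Fin.natAdd_eq_addNat, Finsupp.single_apply, Matrix.one_apply, eq_comm] <;>
      split_ifs <;> simp
  have hfac : ((-1 : ℂ) ^ (n * (n - 1) / 2) * (n.factorial : ℂ)) ≠ 0 := by
    simp [Nat.factorial_ne_zero]
  have htop0 : topPow ω n ≠ 0 := by
    intro h
    have h1 := DFunLike.congr_fun (htop.symm.trans h) (Fin.append b (fun k => I • b k))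
    rw [AlternatingMap.smul_apply, hone] at h1
    exact hfac (by simpa using h1)
  have hαb := eq_smul_detForm_coord b hα
  have hab : α b ≠ 0 := fun h => hα0 (by rw [hαb, h, zero_smul])
  set a := α b with ha
  have hwedge : wedgeC α (conjAlt α) =
      (normSq a * (-2 * I) ^ n * (-1) ^ (n * (n - 1) / 2) / n.factorial : ℂ) • topPow ω n := by
    rw [hαb, conjAlt_smul_detForm, wedgeC_smul, wedgeC_detForm, hzbar]
    change _ • detForm (Fin.append z _) = _
    rw [hz, detForm_append_add_sub, htop, smul_smul, smul_smul, mul_conj]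
    congr 1
    have hsq : ((-1 : ℂ) ^ (n * (n - 1) / 2)) * (-1 : ℂ) ^ (n * (n - 1) / 2) = 1 := by
      rw [← mul_pow]; simp
    have hf : (n.factorial : ℂ) ≠ 0 := by simp [Nat.factorial_ne_zero]
    calc (normSq a * (-2 * I) ^ n : ℂ)
        = normSq a * (-2 * I) ^ n * ((-1) ^ (n * (n - 1) / 2) * (-1) ^ (n * (n - 1) / 2)) *
            (n.factorial / n.factorial) := by rw [hsq, div_self hf, mul_one, mul_one]
      _ = _ := by ring
  refine ⟨normSq a * 2 ^ n / n.factorial, by have := normSq_pos.mpr hab; positivity, ?_⟩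
  rw [hermForm, pairing_eq_of_eq_smul htop0 hwedge]
  push_cast
  rw [← I_zpow_mul_eq hn]
  ring

end ComplexModule

/-- the Hermitian form `⟨α, β⟩_j = i^{n(2−n)} · (α ∧ β̄ / ω^{∧n})`
on `Λ^{n,0}_j E*` is positive definite. -/
theorem statement2 {E : Type*} [AddCommGroup E] [Module ℝ E] [FiniteDimensional ℝ E]
    (n : ℕ) (hn : 0 < n) (ω : E [⋀^Fin 2]→ₗ[ℝ] ℝ)
    (hdim : Module.finrank ℝ E = 2 * n) (hnd : OmNondeg ω)
    (j : E →ₗ[ℝ] E) (hj : IsCplxStruct j) (hc : OmCompat ω j) (hp : OmPos ω j) :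
    ∀ α ∈ Lam j n, α ≠ 0 → ∃ r : ℝ, 0 < r ∧ hermForm ω n α α = (r : ℂ) := by
  intro α hα hα0
  let J : ℂ →ₐ[ℝ] Module.End ℝ E := Complex.liftAux j (by ext x; simp [hj x])
  let _ : Module ℂ E := Module.compHom E J.toRingHom
  have hI (x : E) : I • x = j x := by
    change J I x = j x
    rw [Complex.liftAux_apply_I]
  have : IsScalarTower ℝ ℂ E := ⟨fun r c x => by
    change J (r • c) x = r • J c x
    rw [map_smul]
    rfl⟩
  exact hermForm_self_pos hn hdim ω (fun x y => by simpa only [hI] using hc x y)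
    (fun x hx => by simpa only [hI] using hp x hx)
    (fun v i hi => by simpa only [hI] using hα v i hi) hα0

end
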